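/- Let p be a prime, k ≥ 1, and let t_1, …, t_k be integers with p not dividing t_k. Let C(X) = X^k - t_1·X^{k-1} - … - t_k, let A_p be the companion matrix of C reduced mod p (an invertible matrix over ℤ/pℤ), and let c_p be the multiplicative order of A_p. Then p divides c_p if and only if the reduction of C modulo p is not squarefree (i.e., if and only if p ramifies). -/

import Mathlib

/-- The companion matrix of the core polynomial
`C(X) = X^k - t_1 X^{k-1} - ... - t_k`, where `t i` is `t_{i+1}` (0-indexed):
entries `(i, i+1)` equal `1`, the last row is `(t_k, t_{k-1}, ..., t_1)`,
and all other entries are `0`. -/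
def coreCompanion {R : Type*} [CommRing R] {k : ℕ} (t : Fin k → R) :
    Matrix (Fin k) (Fin k) R :=
  Matrix.of fun i j =>
    if (i : ℕ) + 1 = (j : ℕ) then 1
    else if (i : ℕ) = k - 1 then t ⟨k - 1 - (j : ℕ), by have := j.isLt; omega⟩
    else 0

/-- The core polynomial `C(X) = X^k - t_1 X^{k-1} - ... - t_k`. -/
noncomputable def corePoly {R : Type*} [CommRing R] {k : ℕ} (t : Fin k → R) :
    Polynomial R :=
  Polynomial.X ^ k - ∑ i : Fin k, Polynomial.C (t i) * Polynomial.X ^ (k - 1 - (i : ℕ))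

open Polynomial

theorem coreCompanion_pow_mul_apply_zero {R : Type*} [CommRing R] {k : ℕ} (t : Fin k → R)
    {i : ℕ} (hi : i < k) (B : Matrix (Fin k) (Fin k) R) (j : Fin k) :
    (coreCompanion t ^ i * B) ⟨0, by omega⟩ j = B ⟨i, hi⟩ j := by
  induction i generalizing B with
  | zero => simp
  | succ i ih =>
    rw [pow_succ, Matrix.mul_assoc, ih (by omega), Matrix.mul_apply,
      Finset.sum_eq_single ⟨i + 1, hi⟩]
    · simp [coreCompanion]
    · intro l _ hl
      have h₁ : ¬ i + 1 = (l : ℕ) := fun h => hl (Fin.ext h.symm)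
      have h₂ : ¬ i = k - 1 := by omega
      simp [coreCompanion, h₁, h₂]
    · simp

theorem coreCompanion_pow_apply_zero {R : Type*} [CommRing R] {k : ℕ} (t : Fin k → R)
    {i : ℕ} (hi : i < k) (j : Fin k) :
    (coreCompanion t ^ i) ⟨0, by omega⟩ j = if i = (j : ℕ) then 1 else 0 := by
  simpa [Matrix.one_apply, Fin.ext_iff] using coreCompanion_pow_mul_apply_zero t hi 1 j

theorem coreCompanion_pow_self_apply_zero {R : Type*} [CommRing R] {k : ℕ} (hk : 0 < k)
    (t : Fin k → R) (j : Fin k) :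
    (coreCompanion t ^ k) ⟨0, hk⟩ j = t j.rev := by
  obtain ⟨m, rfl⟩ : ∃ m, k = m + 1 := ⟨k - 1, by omega⟩
  rw [pow_succ, coreCompanion_pow_mul_apply_zero t (Nat.lt_succ_self m)]
  have h' : ¬ m + 1 = (j : ℕ) := by omega
  simp only [coreCompanion, Matrix.of_apply, h', if_false, Nat.add_sub_cancel, if_true]
  congr 1
  ext
  simp [Fin.val_rev]

theorem aeval_coreCompanion_corePoly {R : Type*} [CommRing R] {k : ℕ} (t : Fin k → R) :
    aeval (coreCompanion t) (corePoly t) = 0 := by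
  have key (hk : 0 < k) (j : Fin k) :
      aeval (coreCompanion t) (corePoly t) ⟨0, hk⟩ j = 0 := by
    simp only [corePoly, map_sub, map_pow, aeval_X, map_sum, map_mul, aeval_C, Matrix.sub_apply,
      Matrix.sum_apply, ← Algebra.smul_def, Matrix.smul_apply,
      coreCompanion_pow_self_apply_zero hk]
    rw [Finset.sum_eq_single j.rev]
    · rw [coreCompanion_pow_apply_zero t (by omega), if_pos (by rw [Fin.val_rev]; omega)]
      simp
    · intro i _ hi
      rw [coreCompanion_pow_apply_zero t (by omega), if_neg, smul_zero]
      rintro h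
      apply hi
      ext
      rw [Fin.val_rev]
      omega
    · simp
  ext i j
  have hk : 0 < k := i.pos
  have hcomm : coreCompanion t ^ (i : ℕ) * aeval (coreCompanion t) (corePoly t) =
      aeval (coreCompanion t) (corePoly t) * coreCompanion t ^ (i : ℕ) := by
    rw [← aeval_X_pow (R := R) (coreCompanion t), ← map_mul, ← map_mul, mul_comm]
  refine (coreCompanion_pow_mul_apply_zero t i.isLt
    (aeval (coreCompanion t) (corePoly t)) j).symm.trans ?_
  rw [hcomm, Matrix.mul_apply]
  simp [key hk]

theorem degree_sum_corePoly_lt {R : Type*} [CommRing R] {k : ℕ} (t : Fin k → R) :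
    (∑ i : Fin k, C (t i) * X ^ (k - 1 - (i : ℕ))).degree < (k : WithBot ℕ) := by
  refine (degree_sum_le _ _).trans_lt ((Finset.sup_lt_iff (WithBot.bot_lt_coe k)).2 fun i _ => ?_)
  refine (degree_C_mul_X_pow_le _ _).trans_lt ?_
  have := i.isLt
  exact Nat.cast_lt.2 (by omega)

theorem corePoly_monic {R : Type*} [CommRing R] {k : ℕ} (t : Fin k → R) :
    (corePoly t).Monic :=
  monic_X_pow_sub (degree_sum_corePoly_lt t)

theorem degree_corePoly {R : Type*} [CommRing R] [Nontrivial R] {k : ℕ} (t : Fin k → R) :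
    (corePoly t).degree = k := by
  rw [corePoly, degree_sub_eq_left_of_degree_lt, degree_X_pow]
  rw [degree_X_pow]
  exact degree_sum_corePoly_lt t

theorem aeval_coreCompanion_eq_zero_iff {R : Type*} [CommRing R] [Nontrivial R] {k : ℕ}
    (t : Fin k → R) (f : R[X]) :
    aeval (coreCompanion t) f = 0 ↔ corePoly t ∣ f := by
  refine ⟨fun h => ?_, ?_⟩
  · have hr : aeval (coreCompanion t) (f %ₘ corePoly t) = 0 := by
      rw [modByMonic_eq_sub_mul_div _ (corePoly t), map_sub, map_mul,
        aeval_coreCompanion_corePoly, h, zero_mul, sub_zero]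
    have hdeg : (f %ₘ corePoly t).degree < k :=
      degree_corePoly t ▸ degree_modByMonic_lt f (corePoly_monic t)
    rw [← modByMonic_eq_zero_iff_dvd (corePoly_monic t)]
    ext j
    by_cases hj : j < k
    · have h₀ := congrFun (congrFun hr ⟨0, by omega⟩) ⟨j, hj⟩
      have hnat : (f %ₘ corePoly t).natDegree < k := by
        rcases eq_or_ne (f %ₘ corePoly t) 0 with h0 | h0
        · rw [h0, natDegree_zero]
          omega
        · exact (natDegree_lt_iff_degree_lt h0).2 hdeg
      rw [aeval_eq_sum_range' hnat, Matrix.sum_apply, Finset.sum_eq_single j] at h₀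
      · simpa [coreCompanion_pow_apply_zero t hj] using h₀
      · intro i hi hij
        simp [coreCompanion_pow_apply_zero t (Finset.mem_range.1 hi), hij]
      · simp [hj]
    · exact coeff_eq_zero_of_degree_lt (hdeg.trans_le (by exact_mod_cast not_lt.1 hj))
  · rintro ⟨g, rfl⟩
    rw [map_mul, aeval_coreCompanion_corePoly, zero_mul]

theorem coreCompanion_pow_eq_one_iff {R : Type*} [CommRing R] [Nontrivial R] {k : ℕ}
    (t : Fin k → R) (n : ℕ) :
    coreCompanion t ^ n = 1 ↔ corePoly t ∣ X ^ n - 1 := by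
  rw [← aeval_coreCompanion_eq_zero_iff]
  simp [sub_eq_zero]

theorem coeff_zero_corePoly {R : Type*} [CommRing R] {k : ℕ} (hk : 0 < k) (t : Fin k → R) :
    (corePoly t).coeff 0 = -t ⟨k - 1, by omega⟩ := by
  rw [corePoly, coeff_sub, coeff_X_pow, if_neg (by omega), zero_sub, finsetSum_coeff,
    Finset.sum_eq_single ⟨k - 1, by omega⟩]
  · simp
  · intro i _ hi
    rw [coeff_C_mul, coeff_X_pow, if_neg, mul_zero]
    intro h
    apply hi
    ext
    simp only
    omega
  · simp

theorem isUnit_coreCompanion {R : Type*} [CommRing R] {k : ℕ} (hk : 0 < k) (t : Fin k → R)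
    (ht : IsUnit (t ⟨k - 1, by omega⟩)) : IsUnit (coreCompanion t) := by
  have h := aeval_coreCompanion_corePoly t
  rw [← divX_mul_X_add (corePoly t), coeff_zero_corePoly hk, map_add, map_mul, aeval_X, aeval_C,
    map_neg, add_neg_eq_zero] at h
  have hu := h ▸ ht.map (algebraMap R (Matrix (Fin k) (Fin k) R))
  rw [Matrix.isUnit_iff_isUnit_det, Matrix.det_mul] at hu
  exact (Matrix.isUnit_iff_isUnit_det _).2 (isUnit_of_mul_isUnit_right hu)

theorem p_divides_period_iff_ramified
    (p : ℕ) [Fact p.Prime] (k : ℕ) (hk : 1 ≤ k) (t : Fin k → ℤ)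
    (ht : ¬ (p : ℤ) ∣ t ⟨k - 1, by omega⟩) :
    p ∣ orderOf (coreCompanion (fun i => (t i : ZMod p))) ↔
      ¬ Squarefree (corePoly (fun i => (t i : ZMod p))) := by
  have hp : p.Prime := Fact.out
  set s : Fin k → ZMod p := fun i => (t i : ZMod p)
  constructor
  · rintro ⟨m, hm⟩ hsq
    have hunit : IsUnit (coreCompanion s) :=
      isUnit_coreCompanion hk s (isUnit_iff_ne_zero.2 fun h =>
        ht ((ZMod.intCast_zmod_eq_zero_iff_dvd _ p).1 h))
    have hpos : 0 < orderOf (coreCompanion s) := by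
      obtain ⟨u, hu⟩ := hunit
      rw [← hu, orderOf_units]
      exact orderOf_pos u
    have hdvd := (coreCompanion_pow_eq_one_iff s _).1 (pow_orderOf_eq_one (coreCompanion s))
    rw [hm, mul_comm, pow_mul, ← one_pow (M := (ZMod p)[X]) p, ← sub_pow_char] at hdvd
    have hone := (coreCompanion_pow_eq_one_iff s m).2
      ((hsq.dvd_pow_iff_dvd hp.ne_zero).1 hdvd)
    have hmpos : 0 < m := Nat.pos_of_mul_pos_left (hm ▸ hpos)
    have hle := orderOf_le_of_pow_eq_one hmpos hone
    rw [hm] at hle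
    nlinarith [hp.two_le]
  · contrapose!
    intro hn
    have hsep := separable_X_pow_sub_C' p _ (1 : ZMod p) hn one_ne_zero
    rw [map_one] at hsep
    exact hsep.squarefree.squarefree_of_dvd
      ((coreCompanion_pow_eq_one_iff s _).1 (pow_orderOf_eq_one _))
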